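/- arXiv:2109.06724 — 4 statements merged into one kernel-verified Lean document; each statement's English description precedes it below -/
import Mathlib

section
/- If ξ = (ξ₁,ξ₂) : ℝ → ℝ² is differentiable and satisfies the target dynamics ξ₁'(t) = ξ₂(t) and ξ₂'(t) = ρ(ξ₁(t)) + β(ξ₁(t))ξ₂(t)² for all t, then the function t ↦ H(ξ₁(t),ξ₂(t)) is constant; in particular every trajectory of the target dynamics remains for all time in the level set {ξ ∈ ℝ² : H(ξ) = H(ξ(0))}. -/
open Real

/-- Every differentiable solution of the target dynamics
`ξ₁' = ξ₂`, `ξ₂' = ρ(ξ₁) + β(ξ₁)ξ₂²` conserves the target Hamiltonian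
`H(ξ₁,ξ₂) = ½ m(ξ₁) ξ₂² + U(ξ₁)`; in particular the trajectory remains for all
time in the level set `{ξ : H(ξ) = H(ξ(0))}`. -/
theorem stmt_1
    (β ρ : ℝ → ℝ) (hβ : Continuous β) (hρ : Continuous ρ)
    (m U : ℝ → ℝ) (H : ℝ → ℝ → ℝ)
    (hm : ∀ x, m x = Real.exp (-2 * ∫ s in (0:ℝ)..x, β s))
    (hU : ∀ x, U x = -∫ s in (0:ℝ)..x, ρ s * m s)
    (hH : ∀ ξ₁ ξ₂, H ξ₁ ξ₂ = (1/2) * m ξ₁ * ξ₂^2 + U ξ₁)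
    (ξ₁ ξ₂ : ℝ → ℝ)
    (hd1 : ∀ t, HasDerivAt ξ₁ (ξ₂ t) t)
    (hd2 : ∀ t, HasDerivAt ξ₂ (ρ (ξ₁ t) + β (ξ₁ t) * (ξ₂ t)^2) t) :
    (∀ t s : ℝ, H (ξ₁ t) (ξ₂ t) = H (ξ₁ s) (ξ₂ s)) ∧
    (∀ t : ℝ, (ξ₁ t, ξ₂ t) ∈ {p : ℝ × ℝ | H p.1 p.2 = H (ξ₁ 0) (ξ₂ 0)}) := by
  have hm' : ∀ x, HasDerivAt m (-2 * β x * m x) x := by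
    intro x
    have h := ((hβ.integral_hasStrictDerivAt 0 x).hasDerivAt.const_mul (-2)).exp
    rw [← hm x, mul_comm] at h
    exact h.congr_of_eventuallyEq (.of_forall hm)
  have hm_cont : Continuous m :=
    continuous_iff_continuousAt.2 fun x => (hm' x).continuousAt
  have hU' : ∀ x, HasDerivAt U (-(ρ x * m x)) x := fun x =>
    ((hρ.mul hm_cont).integral_hasStrictDerivAt 0 x).hasDerivAt.neg.congr_of_eventuallyEq
      (.of_forall hU)
  have hH' : ∀ t, HasDerivAt (fun t => H (ξ₁ t) (ξ₂ t)) 0 t := by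
    intro t
    have h := ((((hm' (ξ₁ t)).comp t (hd1 t)).const_mul (1 / 2)).mul ((hd2 t).pow 2)).add
      ((hU' (ξ₁ t)).comp t (hd1 t))
    refine (h.congr_of_eventuallyEq (.of_forall fun s => hH _ _)).congr_deriv ?_
    simp only [Function.comp_apply, Pi.pow_apply]
    push_cast
    ring
  have hconst : ∀ t s : ℝ, H (ξ₁ t) (ξ₂ t) = H (ξ₁ s) (ξ₂ s) :=
    is_const_of_deriv_eq_zero (fun t => (hH' t).differentiableAt) fun t => (hH' t).deriv
  exact ⟨hconst, fun t => hconst t 0⟩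
end

section
/- (Closed-loop off-the-manifold dynamics are linear.) Let γ₁, γ₂ > 0 and let x = (x₁,x₂,x₃,x₄) : ℝ → ℝ⁴ be differentiable and satisfy ẋ₁ = x₃, ẋ₂ = x₄, ẋ₃ = −(1/m_uu(x₁))(c̄_u(x₁)x₄² + c_a(x₁)x₃² + ∂₁V_u(x₁,x₂)) − (m_au(x₁)/m_uu(x₁)) v(t), ẋ₄ = v(t), where v(t) := ( −K'(x₁)(c̄_u(x₁)x₄² + c_a(x₁)x₃²) − K'(x₁)∂₁V_u(x₁,x₂) + m_uu(x₁)K''(x₁)x₃² − m_uu(x₁)(γ₁ z₁ + γ₂ z₂) ) / 𝔰(x₁), with z₁ := x₂ − K(x₁) and z₂ := x₄ − K'(x₁)x₃. Then for all t: ż₁(t) = z₂(t) and ż₂(t) = −γ₁ z₁(t) − γ₂ z₂(t). -/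
open Real

/-- Closed-loop off-the-manifold dynamics are linear: with the
I&I controller
`v = (−K'(c̄_u x₄² + c_a x₃²) − K'∂₁V_u(x₁,x₂) + m_uu K''x₃² − m_uu(γ₁z₁ + γ₂z₂))/𝔰`,
the off-the-manifold coordinates `z₁ = x₂ − K(x₁)`, `z₂ = x₄ − K'(x₁)x₃`
satisfy `ż₁ = z₂` and `ż₂ = −γ₁ z₁ − γ₂ z₂`. -/
theorem stmt_6
    (muu mau cu ca : ℝ → ℝ)
    (hmuu : Continuous muu) (hmau : Continuous mau)
    (hcu : Continuous cu) (hca : Continuous ca)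
    (hmuu0 : ∀ x, muu x ≠ 0)
    (V V₁ : ℝ → ℝ → ℝ)
    (hV : ∀ a b : ℝ, HasDerivAt (fun x => V x b) (V₁ a b) a)
    (hV₁ : Continuous (fun p : ℝ × ℝ => V₁ p.1 p.2))
    (K K' K'' : ℝ → ℝ)
    (hK : ∀ x, HasDerivAt K (K' x) x)
    (hK' : ∀ x, HasDerivAt K' (K'' x) x)
    (hK'' : Continuous K'')
    (𝔰 : ℝ → ℝ)
    (h𝔰 : ∀ x, 𝔰 x = muu x + mau x * K' x)
    (h𝔰0 : ∀ x, 𝔰 x ≠ 0)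
    (γ₁ γ₂ : ℝ) (hγ₁ : 0 < γ₁) (hγ₂ : 0 < γ₂)
    (x₁ x₂ x₃ x₄ : ℝ → ℝ)
    (z₁ z₂ v : ℝ → ℝ)
    (hz₁ : ∀ t, z₁ t = x₂ t - K (x₁ t))
    (hz₂ : ∀ t, z₂ t = x₄ t - K' (x₁ t) * x₃ t)
    (hv : ∀ t, v t =
      (-(K' (x₁ t)) * (cu (x₁ t) * (x₄ t)^2 + ca (x₁ t) * (x₃ t)^2)
        - K' (x₁ t) * V₁ (x₁ t) (x₂ t)
        + muu (x₁ t) * K'' (x₁ t) * (x₃ t)^2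
        - muu (x₁ t) * (γ₁ * z₁ t + γ₂ * z₂ t)) / 𝔰 (x₁ t))
    (hx₁ : ∀ t, HasDerivAt x₁ (x₃ t) t)
    (hx₂ : ∀ t, HasDerivAt x₂ (x₄ t) t)
    (hx₃ : ∀ t, HasDerivAt x₃
      (-(1 / muu (x₁ t)) * (cu (x₁ t) * (x₄ t)^2 + ca (x₁ t) * (x₃ t)^2
          + V₁ (x₁ t) (x₂ t)) - (mau (x₁ t) / muu (x₁ t)) * v t) t)
    (hx₄ : ∀ t, HasDerivAt x₄ (v t) t) :
    ∀ t : ℝ,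
      HasDerivAt z₁ (z₂ t) t ∧
      HasDerivAt z₂ (-γ₁ * z₁ t - γ₂ * z₂ t) t := by
  intro t
  have hm := hmuu0 (x₁ t)
  have hvs := (eq_div_iff (h𝔰0 (x₁ t))).mp (hv t)
  rw [h𝔰] at hvs
  constructor
  · rw [funext hz₁, hz₂ t]
    exact (hx₂ t).sub ((hK (x₁ t)).comp t (hx₁ t))
  · have hz : z₂ = x₄ - K' ∘ x₁ * x₃ := funext hz₂
    have hd := (hx₄ t).sub (((hK' (x₁ t)).comp t (hx₁ t)).mul (hx₃ t))
    rw [← hz] at hd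
    refine hd.congr_deriv ?_
    simp only [Function.comp_apply]
    field_simp
    linear_combination hvs
end

section
/- (Comparison boundedness lemma.) Let a₁, a₂ ≥ 0 and k₁, k₂ > 0, and let h : [0,∞) → [0,∞) be differentiable and satisfy h'(t) ≤ a₁ e^{−k₁ t} h(t) + a₂ e^{−k₂ t} √(h(t)) for all t ≥ 0. Then h is bounded on [0,∞), i.e., sup_{t ≥ 0} h(t) < ∞. -/
open Real

/-- Comparison boundedness lemma: if `a₁, a₂ ≥ 0`, `k₁, k₂ > 0`
and `h : [0,∞) → [0,∞)` is differentiable with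
`h'(t) ≤ a₁e^{−k₁t}h(t) + a₂e^{−k₂t}√(h(t))` for all `t ≥ 0`,
then `h` is bounded on `[0,∞)`. -/
theorem stmt_10 (a₁ a₂ k₁ k₂ : ℝ)
    (ha₁ : 0 ≤ a₁) (ha₂ : 0 ≤ a₂) (hk₁ : 0 < k₁) (hk₂ : 0 < k₂)
    (h h' : ℝ → ℝ)
    (hpos : ∀ t ≥ (0:ℝ), 0 ≤ h t)
    (hdiff : ∀ t ≥ (0:ℝ), HasDerivWithinAt h (h' t) (Set.Ici 0) t)
    (hineq : ∀ t ≥ (0:ℝ),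
      h' t ≤ a₁ * Real.exp (-k₁ * t) * h t
              + a₂ * Real.exp (-k₂ * t) * Real.sqrt (h t)) :
    ∃ M : ℝ, ∀ t ≥ (0:ℝ), h t ≤ M := by
  set c : ℝ → ℝ := fun t => a₁ * exp (-k₁ * t) + a₂ * exp (-k₂ * t) with hc
  set φ : ℝ → ℝ := fun t => a₁ / k₁ * exp (-k₁ * t) + a₂ / k₂ * exp (-k₂ * t) with hφ
  have hφ_nonneg : ∀ t, 0 ≤ φ t := fun t => by positivity
  have hφ_deriv : ∀ t, HasDerivAt φ (-c t) t := fun t => by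
    have hexp (k : ℝ) : HasDerivAt (fun s => exp (-k * s)) (exp (-k * t) * -k) t := by
      simpa using ((hasDerivAt_id t).const_mul (-k)).exp
    refine (((hexp k₁).const_mul (a₁ / k₁)).add ((hexp k₂).const_mul (a₂ / k₂))).congr_deriv ?_
    simp only [hc]
    field_simp
    ring
  have hlin : ∀ t ≥ (0:ℝ), h' t ≤ c t * (h t + 1) := fun t ht => by
    have hsqrt : √(h t) ≤ h t + 1 := by
      nlinarith [sq_sqrt (hpos t ht), sq_nonneg (√(h t) - 1), hpos t ht]
    have h₁ : 0 ≤ a₁ * exp (-k₁ * t) := by positivity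
    have h₂ : a₂ * exp (-k₂ * t) * √(h t) ≤ a₂ * exp (-k₂ * t) * (h t + 1) := by gcongr
    simp only [hc]
    linarith [hineq t ht]
  have hderiv : ∀ t ≥ (0:ℝ), HasDerivWithinAt (fun s => (h s + 1) * exp (φ s))
      ((h' t - c t * (h t + 1)) * exp (φ t)) (Set.Ici 0) t := fun t ht =>
    (((hdiff t ht).add_const 1).mul (hφ_deriv t).exp.hasDerivWithinAt).congr_deriv (by ring)
  have hanti : AntitoneOn (fun s => (h s + 1) * exp (φ s)) (Set.Ici 0) :=
    antitoneOn_of_hasDerivWithinAt_nonpos (convex_Ici 0)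
      (fun t ht => (hderiv t ht).continuousWithinAt)
      (fun t ht => (hderiv t (interior_subset ht)).mono interior_subset)
      (fun t ht => mul_nonpos_of_nonpos_of_nonneg
        (sub_nonpos.2 (hlin t (interior_subset ht))) (exp_pos _).le)
  refine ⟨(h 0 + 1) * exp (φ 0), fun t ht => ?_⟩
  calc h t ≤ h t + 1 := by linarith
    _ ≤ (h t + 1) * exp (φ t) :=
      le_mul_of_one_le_right (by linarith [hpos t ht]) (one_le_exp (hφ_nonneg t))
    _ ≤ (h 0 + 1) * exp (φ 0) := hanti Set.self_mem_Ici ht ht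
end

section
/- (Explicit solution of the comparison system.) Let a₁, a₂, k₁, k₂ > 0 and C₁ > 0. Define F(t) := ∫₀^t (1/2) a₂ exp((a₁/(2k₁)) e^{−k₁ s}) e^{−k₂ s} ds + C₁ and G(t) := exp((a₁/(2k₁)) e^{−k₁ t}), and r(t) := (F(t)/G(t))². Then r is differentiable on [0,∞) and satisfies ṙ(t) = a₁ e^{−k₁ t} r(t) + a₂ e^{−k₂ t} √(r(t)) for all t ≥ 0, with r(t) > 0. -/
open Real

/-- Explicit solution of the comparison system: with
`F(t) = ∫₀ᵗ ½a₂ exp((a₁/(2k₁))e^{−k₁s}) e^{−k₂s} ds + C₁`,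
`G(t) = exp((a₁/(2k₁))e^{−k₁t})` and `r = (F/G)²`, the function `r` is
differentiable on `[0,∞)` and satisfies
`ṙ(t) = a₁e^{−k₁t}r(t) + a₂e^{−k₂t}√(r(t))` for all `t ≥ 0`, with `r(t) > 0`. -/
theorem stmt_11 (a₁ a₂ k₁ k₂ C₁ : ℝ)
    (ha₁ : 0 < a₁) (ha₂ : 0 < a₂) (hk₁ : 0 < k₁) (hk₂ : 0 < k₂) (hC₁ : 0 < C₁)
    (F G r : ℝ → ℝ)
    (hF : ∀ t, F t =
      (∫ s in (0:ℝ)..t,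
        (1/2) * a₂ * Real.exp ((a₁ / (2 * k₁)) * Real.exp (-k₁ * s))
          * Real.exp (-k₂ * s)) + C₁)
    (hG : ∀ t, G t = Real.exp ((a₁ / (2 * k₁)) * Real.exp (-k₁ * t)))
    (hr : ∀ t, r t = (F t / G t)^2) :
    ∀ t ≥ (0:ℝ),
      HasDerivAt r
        (a₁ * Real.exp (-k₁ * t) * r t
          + a₂ * Real.exp (-k₂ * t) * Real.sqrt (r t)) t ∧
      0 < r t := by
  intro t ht
  have hcont : Continuous fun s : ℝ =>
      (1/2) * a₂ * Real.exp ((a₁ / (2 * k₁)) * Real.exp (-k₁ * s)) * Real.exp (-k₂ * s) := by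
    fun_prop
  have hFd : HasDerivAt F ((1/2) * a₂ * G t * Real.exp (-k₂ * t)) t := by
    rw [funext hF, hG]
    exact (hcont.integral_hasStrictDerivAt 0 t).hasDerivAt.add_const C₁
  have hGd : HasDerivAt G (-(a₁ / 2) * Real.exp (-k₁ * t) * G t) t := by
    rw [funext hG]
    convert ((((hasDerivAt_id' t).const_mul (-k₁)).exp).const_mul (a₁ / (2 * k₁))).exp using 1
    field_simp
  have hGpos : 0 < G t := by
    rw [hG]
    positivity
  have hFpos : 0 < F t := by
    rw [hF]
    have hint := intervalIntegral.integral_nonneg (μ := MeasureTheory.volume) ht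
      (fun s _ => show 0 ≤ (1/2) * a₂ * Real.exp ((a₁ / (2 * k₁)) * Real.exp (-k₁ * s))
        * Real.exp (-k₂ * s) by positivity)
    linarith
  have hpos : 0 < F t / G t := div_pos hFpos hGpos
  refine ⟨?_, by rw [hr]; positivity⟩
  rw [hr t, Real.sqrt_sq hpos.le, funext hr]
  refine ((hFd.div hGd hGpos.ne').pow 2).congr_deriv ?_
  simp only [Pi.div_apply, Nat.reduceSub, pow_one, Nat.cast_ofNat]
  field_simp
  ring
end
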